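/- arXiv:1302.1480 — 2 statements merged into one kernel-verified Lean document; each statement's English description precedes it below -/
import Mathlib

section
/- Let 𝒜 be an associative ring with identity 1 and let a, b, d ∈ 𝒜. Then b is the Mary inverse of a along d if and only if b is an outer inverse of a (i.e., b·a·b = b) and there exists t ∈ 𝒜 such that d·t·d = d, t·d·t = t, b·a = d·t and a·b = t·d. -/
/-- **Theorem (Mary inverse as outer inverse with prescribed idempotents, ring case).**
Let `𝒜` be an associative ring with identity and `a b d ∈ 𝒜`. Then `b` is the Mary
inverse of `a` along `d` (i.e. `b * a * b = b`, `b𝒜 = d𝒜` and `𝒜b = 𝒜d`) if and only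
if `b` is an outer inverse of `a` and there is a reflexive inverse `t` of `d` with
`b * a = d * t` and `a * b = t * d`. -/
theorem mary_iff_outer_with_reflexive {𝒜 : Type*} [Ring 𝒜] (a b d : 𝒜) :
    (b * a * b = b ∧ (∃ x : 𝒜, b = d * x) ∧ (∃ y : 𝒜, d = b * y) ∧
      (∃ u : 𝒜, b = u * d) ∧ (∃ v : 𝒜, d = v * b)) ↔
    (b * a * b = b ∧ ∃ t : 𝒜, d * t * d = d ∧ t * d * t = t ∧
      b * a = d * t ∧ a * b = t * d) := by
  constructor
  · rintro ⟨hb, ⟨x, hx⟩, ⟨y, hy⟩, ⟨u, hu⟩, ⟨v, hv⟩⟩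
    have hl : b * a * d = d := by rw [hy, ← mul_assoc, hb]
    have hr : d * (a * b) = d := by rw [hv, mul_assoc, ← mul_assoc b, hb]
    have hdt : d * (a * b * x * a) = b * a := by
      rw [← mul_assoc, ← mul_assoc, hr, ← hx]
    have htd : a * b * x * a * d = a * b :=
      calc a * b * x * a * d = a * (u * d) * x * a * d := by rw [← hu]
        _ = a * u * (d * x * a * d) := by simp only [mul_assoc]
        _ = a * b := by rw [← hx, hl, mul_assoc, ← hu]
    refine ⟨hb, a * b * x * a, by rw [hdt, hl], ?_, hdt.symm, htd.symm⟩
    calc a * b * x * a * d * (a * b * x * a) = a * b * (a * b * x * a) := by rw [htd]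
      _ = a * (b * a * b) * x * a := by simp only [mul_assoc]
      _ = a * b * x * a := by rw [hb]
  · rintro ⟨hb, t, hd, -, hba, hab⟩
    refine ⟨hb, ⟨t * b, ?_⟩, ⟨a * d, ?_⟩, ⟨b * t, ?_⟩, ⟨d * a, ?_⟩⟩
    · rw [← mul_assoc, ← hba, hb]
    · rw [← mul_assoc, hba, hd]
    · rw [mul_assoc, ← hab, ← mul_assoc, hb]
    · rw [mul_assoc, hab, ← mul_assoc, hd]
end

section
/- Let 𝒜 be an associative ring with identity 1, let a, d ∈ 𝒜, let b ∈ 𝒜 be the Mary inverse of a along d, and let g ∈ 𝒜 be a group inverse of a·d (i.e., (a·d)·g·(a·d) = a·d, g·(a·d)·g = g and (a·d)·g = g·(a·d)). Set t := g·a, p := d·t and q := 1 − t·d. Then p and q are idempotents and b·a·b = b, b·a = p and 1 − a·b = q; that is, a is Djordjevic–Wei (p,q)-invertible with (p,q)-inverse b. -/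
/-- **Corollary (Mary invertible implies Djordjevic–Wei `(p,q)`-invertible).**
If `b` is the Mary inverse of `a` along `d` and `g` is a group inverse of `a * d`,
then with `t := g * a`, `p := d * t`, `q := 1 - t * d`, the elements `p` and `q` are
idempotents and `b` is the Djordjevic–Wei `(p,q)`-inverse of `a`. -/
theorem mary_implies_djordjevicWei {𝒜 : Type*} [Ring 𝒜] (a b d g : 𝒜)
    (houter : b * a * b = b)
    (hx : ∃ x : 𝒜, b = d * x) (hy : ∃ y : 𝒜, d = b * y)
    (hu : ∃ u : 𝒜, b = u * d) (hv : ∃ v : 𝒜, d = v * b)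
    (hg1 : a * d * g * (a * d) = a * d)
    (hg2 : g * (a * d) * g = g)
    (hg3 : a * d * g = g * (a * d)) :
    (d * (g * a)) * (d * (g * a)) = d * (g * a) ∧
    (1 - (g * a) * d) * (1 - (g * a) * d) = 1 - (g * a) * d ∧
    b * a * b = b ∧
    b * a = d * (g * a) ∧
    1 - a * b = 1 - (g * a) * d := by
  obtain ⟨x, hx⟩ := hx
  obtain ⟨y, hy⟩ := hy
  obtain ⟨u, hu⟩ := hu
  obtain ⟨v, hv⟩ := hv
  have hbad : b * a * d = d := by
    calc b * a * d = b * a * b * y := by rw [mul_assoc (b * a), ← hy]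
      _ = d := by rw [houter, ← hy]
  have hdab : d * a * b = d := by
    calc d * a * b = v * (b * a * b) := by rw [hv]; noncomm_ring
      _ = d := by rw [houter, ← hv]
  have hdgad : d * g * (a * d) = d := by
    calc d * g * (a * d) = d * (a * d * g) := by rw [hg3, mul_assoc]
      _ = b * a * d * (a * d * g) := by rw [hbad]
      _ = u * d * (a * d * g * (a * d)) := by
        rw [mul_assoc (a * d), ← hg3, hu]; noncomm_ring
      _ = b * a * d := by rw [hg1, hu]; noncomm_ring
      _ = d := hbad
  have hggad : g * g * (a * d) = g := by
    rw [mul_assoc, ← hg3, ← mul_assoc, hg2]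
  have hgab : g * a * b = g := by
    calc g * a * b = g * g * (a * d) * a * b := by rw [hggad]
      _ = g * g * (a * (d * a * b)) := by noncomm_ring
      _ = g := by rw [hdab, hggad]
  have hb : b = d * g := by
    calc b = d * g * (a * d) * x := by rw [hdgad, hx]
      _ = d * (g * a * b) := by rw [hx]; noncomm_ring
      _ = d * g := by rw [hgab]
  have hba : b * a = d * (g * a) := by rw [hb, mul_assoc]
  have hab : a * b = g * a * d := by
    rw [hb, ← mul_assoc, hg3, mul_assoc]
  have hab_idem : IsIdempotentElem (a * b) := by
    rw [IsIdempotentElem, mul_assoc, ← mul_assoc b, houter]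
  refine ⟨?_, ?_, houter, hba, by rw [hab]⟩
  · rw [← hba, ← mul_assoc, houter]
  · rw [← hab]
    exact hab_idem.one_sub
end
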